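/- Let W = W_1^n be a primitive disk word with n > 2. If W is upward, then h(x_i) >= 1 for every index i with 1 < i < n; if W is downward, then h(x_i) <= -1 for every index i with 1 < i < n. In particular, all interior heights of a primitive disk word have the same sign, positive in the upward case and negative in the downward case. -/

import Mathlib

/-- A letter of the alphabet `{X, X⁻¹, Y, Y⁻¹}`. -/
inductive L where
  | X | Xi | Y | Yi
deriving DecidableEq

/-- A word is a finite sequence of letters. -/
abbrev Word := List L

/-- Whether a letter is an `X`-letter, i.e. `X` or `X⁻¹`. -/
def L.isX : L → Bool
  | .X => true
  | .Xi => true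
  | _ => false

/-- The sign of a letter: `+1` for `X`, `-1` for `X⁻¹`, `0` for `Y`-letters. -/
def L.sgn : L → ℤ
  | .X => 1
  | .Xi => -1
  | _ => 0

/-- The formal inverse of a letter. -/
def L.inv : L → L
  | .X => .Xi
  | .Xi => .X
  | .Y => .Yi
  | .Yi => .Y

/-- `phi W` = (number of `X`'s in `W`) - (number of `X⁻¹`'s in `W`). -/
def phi (w : Word) : ℤ := (w.map L.sgn).sum

/-- The subsequence of `X`-letters `x₁, …, xₙ` of a word. -/
def xLetters (w : Word) : Word := w.filter (·.isX)

/-- The number `n` of `X`-letters of a word. -/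
def numX (w : Word) : ℕ := (xLetters w).length

/-- The `i`-th `X`-letter `xᵢ` of a word (1-indexed; junk value `Y` out of range). -/
def xLtr (w : Word) (i : ℕ) : L := (xLetters w).getD (i - 1) L.Y

/-- `phi (W₁ⁱ)`: the sign-sum of the first `i` `X`-letters of `W`. -/
def phiPrefix (w : Word) (i : ℕ) : ℤ := (((xLetters w).take i).map L.sgn).sum

/-- `W` is a disk word: it has `n ≥ 2` `X`-letters, its first letter is `x₁`,
its last letter is `xₙ`, `x₁` and `xₙ` have opposite signs, and `phi W = 0`. -/
def IsDiskWord (w : Word) : Prop :=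
  2 ≤ numX w ∧
  w.head? = (xLetters w).head? ∧
  w.getLast? = (xLetters w).getLast? ∧
  phi w = 0 ∧
  (xLtr w 1).sgn = -(xLtr w (numX w)).sgn

/-- A disk word `W = W₁ⁿ` is primitive if `phi (W₁ᵏ) ≠ 0` for all `1 < k < n`. -/
def IsPrimitive (w : Word) : Prop :=
  IsDiskWord w ∧ ∀ k, 1 < k → k < numX w → phiPrefix w k ≠ 0

/-- A disk word is upward if `x₁ = X`. -/
def Upward (w : Word) : Prop := xLtr w 1 = L.X

/-- A disk word is downward if `x₁ = X⁻¹`. -/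
def Downward (w : Word) : Prop := xLtr w 1 = L.Xi

/-- `eps W i = 1` if `xᵢ` has the same sign as `x₁`, and `0` otherwise. -/
def eps (w : Word) (i : ℕ) : ℤ := if xLtr w i = xLtr w 1 then 1 else 0

/-- The height `h(xᵢ)`: `phi (W₁ⁱ) - eps xᵢ` in the upward case and
`phi (W₁ⁱ) + eps xᵢ` in the downward case. -/
def height (w : Word) (i : ℕ) : ℤ :=
  if xLtr w 1 = L.X then phiPrefix w i - eps w i else phiPrefix w i + eps w i

/-- A word is reduced if it has no adjacent pair of mutually inverse letters. -/
def Reduced (w : Word) : Prop := w.Chain' (fun a b => b ≠ a.inv)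

/-- The (0-indexed) positions in `w` of its `X`-letters. -/
def xPos (w : Word) : List ℕ :=
  (List.range w.length).filter (fun i => (w.getD i L.Y).isX)

/-- `subword w i j` = `Wᵢʲ`, the contiguous subword of `w` from the `i`-th
to the `j`-th `X`-letter (1-indexed, inclusive). -/
def subword (w : Word) (i j : ℕ) : Word :=
  (w.take ((xPos w).getD (j - 1) 0 + 1)).drop ((xPos w).getD (i - 1) 0)

/-- `Y^m`: `m` copies of `Y` if `m ≥ 0`, `-m` copies of `Y⁻¹` if `m < 0`. -/
def Ypow (m : ℤ) : Word :=
  if 0 ≤ m then List.replicate m.toNat L.Y else List.replicate (-m).toNat L.Yi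

theorem phiPrefix_zero (w : Word) : phiPrefix w 0 = 0 := by
  simp [phiPrefix]

theorem phiPrefix_succ (w : Word) {k : ℕ} (hk : k < numX w) :
    phiPrefix w (k + 1) = phiPrefix w k + (xLtr w (k + 1)).sgn := by
  have hk' : k < (xLetters w).length := hk
  rw [phiPrefix, phiPrefix, xLtr, Nat.add_sub_cancel, List.getD_eq_getElem _ _ hk',
    List.take_succ_eq_append_getElem hk']
  simp only [List.map_append, List.sum_append, List.map_cons, List.map_nil, List.sum_singleton]

theorem xLtr_succ_eq (w : Word) {k : ℕ} (hk : k < numX w) :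
    xLtr w (k + 1) = L.X ∨ xLtr w (k + 1) = L.Xi := by
  have hk' : k < (xLetters w).length := hk
  have hX : ((xLetters w)[k]).isX = true := (List.mem_filter.mp (List.getElem_mem hk')).2
  have heq : xLtr w (k + 1) = (xLetters w)[k] := by
    simp [xLtr, List.getElem?_eq_getElem hk']
  rw [heq]
  generalize (xLetters w)[k] = a at hX
  cases a <;> simp_all [L.isX]

/-- Proper nonempty prefixes of a primitive word have `phi` of the same sign as the first letter. -/
theorem one_le_sgn_mul_phiPrefix {w : Word} (hw : IsPrimitive w) {k : ℕ} (hk : 1 ≤ k)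
    (hkn : k < numX w) : 1 ≤ (xLtr w 1).sgn * phiPrefix w k := by
  have hfirst := xLtr_succ_eq w (k := 0) (by omega)
  induction k, hk using Nat.le_induction with
  | base =>
    have h := phiPrefix_succ w (k := 0) (by omega)
    rw [phiPrefix_zero] at h
    rcases hfirst with h1 | h1 <;> simp_all [L.sgn]
  | succ k hk ih =>
    have hprev := ih (by omega)
    have hne := hw.2 (k + 1) (by omega) hkn
    have hstep := phiPrefix_succ w (k := k) (by omega)
    rcases hfirst with h1 | h1 <;> rcases xLtr_succ_eq w (k := k) (by omega) with h2 | h2 <;>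
      simp only [zero_add] at h1 <;> simp only [h1, h2, L.sgn] at * <;> omega

/-- all interior heights of a primitive disk word with `n > 2`
`X`-letters are `≥ 1` in the upward case and `≤ -1` in the downward case. -/
theorem interior_heights_sign (w : Word) (hw : IsPrimitive w) (hn : 2 < numX w) :
    (Upward w → ∀ i, 1 < i → i < numX w → 1 ≤ height w i) ∧
    (Downward w → ∀ i, 1 < i → i < numX w → height w i ≤ -1) := by
  constructor <;> intro hdir i hi hin <;> obtain ⟨k, rfl⟩ : ∃ k, i = k + 1 := ⟨i - 1, by omega⟩ <;>
    have hprev := one_le_sgn_mul_phiPrefix hw (k := k) (by omega) (by omega) <;>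
    have hcur := one_le_sgn_mul_phiPrefix hw (k := k + 1) (by omega) hin <;>
    have hstep := phiPrefix_succ w (k := k) (by omega) <;>
    simp only [Upward, Downward] at hdir <;>
    rcases xLtr_succ_eq w (k := k) (by omega) with h2 | h2 <;>
    simp only [height, eps, hdir, h2, L.sgn, reduceCtorEq, if_true, if_false] at * <;> omega
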